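/- Let $\mu, t \in \mathbb{R}$ and $s > 0$. Let $\varphi : \mathbb{R} \to \mathbb{R}$ be strictly convex on $\mathbb{R}$, differentiable on $\mathbb{R} \setminus \{\mu\}$, with $|\varphi(x)/x| \to \infty$ as $|x| \to \infty$, $\varphi(\mu) = 0$, and global minimum attained at $\mu$. Let $\mathcal{P}(\mu,s,\varphi)$ be the set of Borel probability measures $P$ on $\mathbb{R}$ such that, for $X$ the identity map, $X$ and $\varphi(X)$ are $P$-integrable with $E_P[X] = \mu$ and $E_P[\varphi(X)] = s$. Let $\psi_u : \mathbb{R} \to \mathbb{R}$ be concave and non-decreasing on each of $(-\infty,t)$ and $[t,\infty)$, and let $\psi_\ell : \mathbb{R} \to \mathbb{R}$ be convex and non-increasing on each of $(-\infty,t)$ and $[t,\infty)$. Assume that for every $P \in \mathcal{P}(\mu,s,\varphi)$ the functions $\psi_u(X)$ and $\psi_\ell(X)$ are $P$-integrable and $E_P[\psi_\ell(X)] > 0$. Assume that at least one of the following holds: (a) $E_P[\psi_u(X)] \ge 0$ for some $P \in \mathcal{P}(\mu,s,\varphi)$; (b) $\psi_\ell$ is affine on $(-\infty,t)$ and affine on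 $[t,\infty)$ (for instance, constant on each of the two). Assume further the monotonicity condition: for every fixed $v_1 < \mu$, the function $$v_2 \mapsto \frac{w_1(v_2)\,\psi_u(v_1) + w_2(v_2)\,\psi_u(v_2)}{w_1(v_2)\,\psi_\ell(v_1) + w_2(v_2)\,\psi_\ell(v_2)}, \qquad w_2(v_2) = \frac{\mu - v_1}{v_2 - v_1}, \quad w_1(v_2) = 1 - w_2(v_2),$$ is non-decreasing on $(\mu,\infty)$ (a quotient with denominator $0$ being read as $0$). Then, with suprema taken in $[-\infty,\infty]$, $$\sup_{P \in \mathcal{P}(\mu,s,\varphi)} \frac{E_P[\psi_u(X)]}{E_P[\psi_\ell(X)]} = \sup \frac{w_1\psi_u(v_1) + w_2\psi_u(v_2)}{w_1\psi_\ell(v_1) + w_2\psi_\ell(v_2)},$$ where the supremum on the right is over all $v_1 < \mu < v_2$ and $w_1, w_2 \ge 0$ with $w_1 + w_2 = 1$ such that the two-point distribution $w_1\delta_{v_1} + w_2\delta_{v_2}$ belongs to $\mathcal{P}(\mu,s,\varphi)$. -/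

import Mathlib

open MeasureTheory Filter

/-- The two-point distribution with data `(v1, w1, v2, w2)`. -/
noncomputable def twoPoint (v1 w1 v2 w2 : ℝ) : Measure ℝ :=
  (ENNReal.ofReal w1) • Measure.dirac v1 + (ENNReal.ofReal w2) • Measure.dirac v2

/-- Membership in the ambiguity set `P(μ,s,φ)`. -/
def memAmb (μ s : ℝ) (φ : ℝ → ℝ) (P : Measure ℝ) : Prop :=
  IsProbabilityMeasure P ∧ Integrable (fun x : ℝ => x) P ∧ (∫ x, x ∂P) = μ ∧
  Integrable φ P ∧ (∫ x, φ x ∂P) = s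

/-- The assumption on the dispersion function `φ`. -/
structure DispersionOK (μ : ℝ) (φ : ℝ → ℝ) : Prop where
  strict_convex : StrictConvexOn ℝ Set.univ φ
  diff : ∀ x : ℝ, x ≠ μ → DifferentiableAt ℝ φ x
  growth : Tendsto (fun x : ℝ => |φ x / x|) (cocompact ℝ) atTop
  zero : φ μ = 0
  isMin : ∀ x : ℝ, φ μ ≤ φ x

/-- `ψ` coincides on `S` with an affine function `x ↦ a * x + b`. -/
def AffineOn (ψ : ℝ → ℝ) (S : Set ℝ) : Prop :=
  ∃ a b : ℝ, ∀ x ∈ S, ψ x = a * x + b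

/-- A convex function on a real set has a supporting line at every interior point. -/
theorem ConvexOn.exists_supporting_line {S : Set ℝ} {f : ℝ → ℝ} (hf : ConvexOn ℝ S f) {m : ℝ}
    (hm : m ∈ interior S) : ∃ c : ℝ, ∀ x ∈ S, f m + c * (x - m) ≤ f x := by
  refine ⟨derivWithin f (Set.Ioi m) m, fun x hx => ?_⟩
  rcases lt_trichotomy x m with h | rfl | h
  · have h1 := (hf.slope_le_leftDeriv_of_mem_interior hx hm h).trans
      (hf.leftDeriv_le_rightDeriv_of_mem_interior hm)
    rw [slope_def_field, div_le_iff₀ (by linarith)] at h1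
    linarith
  · simp
  · have h1 := hf.rightDeriv_le_slope_of_mem_interior hm hx h
    rw [slope_def_field, le_div_iff₀ (by linarith)] at h1
    linarith

theorem ae_eq_of_ae_le_of_integral_eq {ρ : Measure ℝ} [IsProbabilityMeasure ρ]
    {f g : ℝ → ℝ} (hf : Integrable f ρ) (hg : Integrable g ρ)
    (hle : f ≤ᵐ[ρ] g) (h : ∫ x, f x ∂ρ = ∫ x, g x ∂ρ) : f =ᵐ[ρ] g :=
  (integral_eq_iff_of_ae_le hf hg hle).1 h

/-- Jensen's inequality on an arbitrary convex subset of the line, without any continuity or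
closedness assumption; the mean belongs to the set. -/
theorem mean_mem_and_jensen {S : Set ℝ} {ρ : Measure ℝ} [IsProbabilityMeasure ρ]
    (hS : Convex ℝ S) (hρ : ∀ᵐ x ∂ρ, x ∈ S) (hid : Integrable (fun x : ℝ => x) ρ) :
    (∫ x, x ∂ρ) ∈ S ∧ ∀ f : ℝ → ℝ, ConvexOn ℝ S f → Integrable f ρ →
      f (∫ x, x ∂ρ) ≤ ∫ x, f x ∂ρ := by
  set m := ∫ x, x ∂ρ with hm
  by_cases hconst : ∀ᵐ x ∂ρ, x = m
  · obtain ⟨x, hx, hxS⟩ := (hconst.and hρ).exists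
    refine ⟨hx ▸ hxS, fun f _ _ => ?_⟩
    have : ∫ x, f x ∂ρ = ∫ _, f m ∂ρ :=
      integral_congr_ae (hconst.mono fun x hx => by simp only [hx])
    rw [this]; simp
  have hmi : ∫ _ : ℝ, m ∂ρ = m := by simp
  have hlt : ∃ x ∈ S, x < m := by
    by_contra! hcon
    refine hconst ?_
    have := ae_eq_of_ae_le_of_integral_eq (integrable_const m) hid
      (hρ.mono fun x hx => hcon x hx) (by rw [hmi])
    exact this.mono fun x hx => hx.symm
  have hgt : ∃ x ∈ S, m < x := by
    by_contra! hcon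
    refine hconst ?_
    exact ae_eq_of_ae_le_of_integral_eq hid (integrable_const m)
      (hρ.mono fun x hx => hcon x hx) (by rw [hmi])
  obtain ⟨a, haS, ha⟩ := hlt
  obtain ⟨b, hbS, hb⟩ := hgt
  have hint : m ∈ interior S := by
    rw [mem_interior_iff_mem_nhds]
    exact mem_of_superset (Icc_mem_nhds ha hb) (hS.ordConnected.out haS hbS)
  refine ⟨interior_subset hint, fun f hf hfi => ?_⟩
  obtain ⟨c, hc⟩ := hf.exists_supporting_line hint
  have hlin : Integrable (fun x => c * (x - m)) ρ := (hid.sub (integrable_const m)).const_mul c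
  have h1 : ∫ x, (f m + c * (x - m)) ∂ρ = f m := by
    rw [integral_add (integrable_const _) hlin, integral_const_mul,
      integral_sub hid (integrable_const m)]
    simp [← hm]
  rw [← h1]
  exact integral_mono_ae ((integrable_const _).add hlin) hfi (hρ.mono fun x hx => hc x hx)

/-- The expectation of `f` under the two-point distribution on `{v1, v2}` with mean `μ`. -/
noncomputable def chordAt (μ : ℝ) (f : ℝ → ℝ) (v1 v2 : ℝ) : ℝ :=
  (1 - (μ - v1) / (v2 - v1)) * f v1 + ((μ - v1) / (v2 - v1)) * f v2

theorem chordAt_eq_div {μ v1 v2 : ℝ} (f : ℝ → ℝ) (h : v1 < v2) :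
    chordAt μ f v1 v2 = ((v2 - μ) * f v1 + (μ - v1) * f v2) / (v2 - v1) := by
  have : v2 - v1 ≠ 0 := by linarith
  unfold chordAt
  field_simp
  ring

theorem integral_eq_cond_add_cond {P : Measure ℝ} [IsProbabilityMeasure P] {A : Set ℝ}
    (hA : MeasurableSet A) (h1 : P A ≠ 0) (h2 : P Aᶜ ≠ 0) {f : ℝ → ℝ} (hf : Integrable f P) :
    ∫ x, f x ∂P = P.real A * ∫ x, f x ∂(ProbabilityTheory.cond P A) +
      P.real Aᶜ * ∫ x, f x ∂(ProbabilityTheory.cond P Aᶜ) := by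
  have e : ∀ B : Set ℝ, P B ≠ 0 →
      P.real B * ∫ x, f x ∂(ProbabilityTheory.cond P B) = ∫ x in B, f x ∂P := by
    intro B hB
    have : P.real B ≠ 0 := by simpa [Measure.real, ENNReal.toReal_eq_zero_iff] using hB
    rw [ProbabilityTheory.cond, integral_smul_measure, ENNReal.toReal_inv, smul_eq_mul,
      ← Measure.real, mul_inv_cancel_left₀ this]
  rw [e _ h1, e _ h2, integral_add_compl hA hf]

theorem integrable_cond {P : Measure ℝ} {A : Set ℝ} (h1 : P A ≠ 0) {f : ℝ → ℝ}
    (hf : Integrable f P) : Integrable f (ProbabilityTheory.cond P A) :=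
  hf.integrableOn.smul_measure (ENNReal.inv_ne_top.2 h1)

/-- Splitting a distribution at a point and collapsing each part to its conditional mean. -/
theorem exists_twoPoint_of_split {P : Measure ℝ} [IsProbabilityMeasure P] {μ τ : ℝ}
    (hid : Integrable (fun x : ℝ => x) P) (hμ : ∫ x, x ∂P = μ)
    (h1 : P (Set.Iio τ) ≠ 0) (h2 : P (Set.Ici τ) ≠ 0) {S1 S2 : Set ℝ} (hS1 : Convex ℝ S1)
    (hS2 : Convex ℝ S2) (hP1 : ∀ᵐ x ∂P, x < τ → x ∈ S1) (hP2 : ∀ᵐ x ∂P, τ ≤ x → x ∈ S2) :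
    ∃ v1 v2 : ℝ, v1 < μ ∧ μ < v2 ∧ ∀ f : ℝ → ℝ, Integrable f P → ConvexOn ℝ S1 f →
      ConvexOn ℝ S2 f → chordAt μ f v1 v2 ≤ ∫ x, f x ∂P := by
  have hc : (Set.Iio τ)ᶜ = Set.Ici τ := Set.compl_Iio
  have := ProbabilityTheory.cond_isProbabilityMeasure h1
  have := ProbabilityTheory.cond_isProbabilityMeasure h2
  have hac := fun B : Set ℝ => ProbabilityTheory.cond_absolutelyContinuous (μ := P) (s := B)
  have m1 := ProbabilityTheory.ae_cond_mem (μ := P) (measurableSet_Iio (a := τ))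
  have m2 := ProbabilityTheory.ae_cond_mem (μ := P) (measurableSet_Ici (a := τ))
  have dec := fun {f : ℝ → ℝ} (hf : Integrable f P) =>
    integral_eq_cond_add_cond measurableSet_Iio h1 (hc ▸ h2) hf
  rw [hc] at dec
  have a1 := (mean_mem_and_jensen (convex_Iio τ) m1 (integrable_cond h1 hid)).1
  have a2 := (mean_mem_and_jensen (convex_Ici τ) m2 (integrable_cond h2 hid)).1
  have j1 := (mean_mem_and_jensen hS1
    ((m1.and ((hac _).ae_le hP1)).mono fun x hx => hx.2 hx.1) (integrable_cond h1 hid)).2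
  have j2 := (mean_mem_and_jensen hS2
    ((m2.and ((hac _).ae_le hP2)).mono fun x hx => hx.2 hx.1) (integrable_cond h2 hid)).2
  have did := dec hid
  have w1 : 0 < P.real (Set.Iio τ) := by
    simpa [Measure.real, ENNReal.toReal_pos_iff, pos_iff_ne_zero] using h1
  have w2 : 0 < P.real (Set.Ici τ) := by
    simpa [Measure.real, ENNReal.toReal_pos_iff, pos_iff_ne_zero] using h2
  have hw : P.real (Set.Iio τ) + P.real (Set.Ici τ) = 1 := by
    rw [← hc, probReal_add_probReal_compl measurableSet_Iio]
  rw [hμ] at did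
  set v1 := ∫ x, x ∂(ProbabilityTheory.cond P (Set.Iio τ))
  set v2 := ∫ x, x ∂(ProbabilityTheory.cond P (Set.Ici τ))
  set p := P.real (Set.Iio τ)
  set q := P.real (Set.Ici τ)
  have h12 : v1 < v2 := lt_of_lt_of_le a1 a2
  have hp : p = 1 - q := by linarith
  have e1 : μ - v1 = q * (v2 - v1) := by rw [did, hp]; ring
  have e2 : v2 - μ = p * (v2 - v1) := by rw [did, hp]; ring
  have hpos : 0 < v2 - v1 := by linarith
  refine ⟨v1, v2, by nlinarith [mul_pos w2 hpos], by nlinarith [mul_pos w1 hpos], ?_⟩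
  intro f hf hf1 hf2
  have k1 := j1 f hf1 (integrable_cond h1 hf)
  have k2 := j2 f hf2 (integrable_cond h2 hf)
  have e3 : (μ - v1) / (v2 - v1) = q := by rw [e1]; field_simp
  rw [dec hf, chordAt, e3, ← hp]
  gcongr

/-- Every non-degenerate distribution with mean `μ` is dominated, for all functions that are convex
on both sides of `t`, by a two-point distribution with mean `μ`. -/
theorem exists_twoPoint_le_integral {P : Measure ℝ} [IsProbabilityMeasure P] {μ : ℝ} (t : ℝ)
    (hid : Integrable (fun x : ℝ => x) P) (hμ : ∫ x, x ∂P = μ) (hne : ¬ ∀ᵐ x ∂P, x = μ) :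
    ∃ v1 v2 : ℝ, v1 < μ ∧ μ < v2 ∧ ∀ f : ℝ → ℝ, Integrable f P → ConvexOn ℝ (Set.Iio t) f →
      ConvexOn ℝ (Set.Ici t) f → chordAt μ f v1 v2 ≤ ∫ x, f x ∂P := by
  have hmi : ∫ _ : ℝ, μ ∂P = μ := by simp
  have n1 : P (Set.Iio μ) ≠ 0 := by
    intro h
    refine hne ?_
    have : ∀ᵐ x ∂P, μ ≤ x := by
      rw [ae_iff]; simpa [Set.Iio] using h
    exact (ae_eq_of_ae_le_of_integral_eq (integrable_const μ) hid this
      (by rw [hmi, hμ])).mono fun x hx => hx.symm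
  have n2 : P (Set.Ici μ) ≠ 0 := by
    intro h
    refine hne ?_
    have : ∀ᵐ x ∂P, x < μ := by
      rw [ae_iff]; simpa [Set.Ici] using h
    exact ae_eq_of_ae_le_of_integral_eq hid (integrable_const μ)
      (this.mono fun x hx => hx.le) (by rw [hmi, hμ])
  by_cases h1 : P (Set.Iio t) = 0
  · have : ∀ᵐ x ∂P, x ∈ Set.Ici t := by
      rw [ae_iff]; simpa [Set.Iio] using h1
    obtain ⟨v1, v2, hv1, hv2, h⟩ := exists_twoPoint_of_split hid hμ n1 n2 (convex_Ici t)
      (convex_Ici t) (this.mono fun x hx _ => hx) (this.mono fun x hx _ => hx)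
    exact ⟨v1, v2, hv1, hv2, fun f hf _ hf2 => h f hf hf2 hf2⟩
  by_cases h2 : P (Set.Ici t) = 0
  · have : ∀ᵐ x ∂P, x ∈ Set.Iio t := by
      rw [ae_iff]; simpa [Set.Ici] using h2
    obtain ⟨v1, v2, hv1, hv2, h⟩ := exists_twoPoint_of_split hid hμ n1 n2 (convex_Iio t)
      (convex_Iio t) (this.mono fun x hx _ => hx) (this.mono fun x hx _ => hx)
    exact ⟨v1, v2, hv1, hv2, fun f hf hf1 _ => h f hf hf1 hf1⟩
  exact exists_twoPoint_of_split hid hμ h1 h2 (convex_Iio t) (convex_Ici t)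
    (Eventually.of_forall fun x hx => hx) (Eventually.of_forall fun x hx => hx)

theorem integrable_twoPoint (v1 w1 v2 w2 : ℝ) (f : ℝ → ℝ) :
    Integrable f (twoPoint v1 w1 v2 w2) :=
  ((integrable_dirac (by simp)).smul_measure ENNReal.ofReal_ne_top).add_measure
    ((integrable_dirac (by simp)).smul_measure ENNReal.ofReal_ne_top)

theorem integral_twoPoint {v1 w1 v2 w2 : ℝ} (h1 : 0 ≤ w1) (h2 : 0 ≤ w2) (f : ℝ → ℝ) :
    ∫ x, f x ∂(twoPoint v1 w1 v2 w2) = w1 * f v1 + w2 * f v2 := by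
  rw [twoPoint, integral_add_measure
    ((integrable_dirac (by simp)).smul_measure ENNReal.ofReal_ne_top)
    ((integrable_dirac (by simp)).smul_measure ENNReal.ofReal_ne_top)]
  simp [integral_smul_measure, h1, h2]

theorem isProbabilityMeasure_twoPoint {v1 w1 v2 w2 : ℝ} (h1 : 0 ≤ w1) (h2 : 0 ≤ w2)
    (h : w1 + w2 = 1) : IsProbabilityMeasure (twoPoint v1 w1 v2 w2) :=
  ⟨by simp [twoPoint, ← ENNReal.ofReal_add h1 h2, h]⟩

theorem weight_mem_Icc {μ v1 v2 : ℝ} (h1 : v1 < μ) (h2 : μ < v2) :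
    0 ≤ 1 - (μ - v1) / (v2 - v1) ∧ 0 ≤ (μ - v1) / (v2 - v1) := by
  have h : 0 < v2 - v1 := by linarith
  constructor
  · rw [sub_nonneg, div_le_one h]; linarith
  · exact div_nonneg (by linarith) h.le

theorem chordAt_id {μ v1 v2 : ℝ} (h : v1 < v2) : chordAt μ (fun x => x) v1 v2 = μ := by
  have : v2 - v1 ≠ 0 := by linarith
  rw [chordAt_eq_div _ h]
  field_simp
  ring

/-- The two-point distribution on `{v1, v2}` with mean `μ`. -/
noncomputable def meanTwoPoint (μ v1 v2 : ℝ) : Measure ℝ :=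
  twoPoint v1 (1 - (μ - v1) / (v2 - v1)) v2 ((μ - v1) / (v2 - v1))

theorem integral_meanTwoPoint {μ v1 v2 : ℝ} (h1 : v1 < μ) (h2 : μ < v2) (f : ℝ → ℝ) :
    ∫ x, f x ∂(meanTwoPoint μ v1 v2) = chordAt μ f v1 v2 :=
  integral_twoPoint (weight_mem_Icc h1 h2).1 (weight_mem_Icc h1 h2).2 f

theorem memAmb_meanTwoPoint {μ s v1 v2 : ℝ} {φ : ℝ → ℝ} (h1 : v1 < μ) (h2 : μ < v2)
    (hs : chordAt μ φ v1 v2 = s) : memAmb μ s φ (meanTwoPoint μ v1 v2) := by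
  refine ⟨isProbabilityMeasure_twoPoint (weight_mem_Icc h1 h2).1 (weight_mem_Icc h1 h2).2 (by ring),
    integrable_twoPoint _ _ _ _ _, ?_, integrable_twoPoint _ _ _ _ _, ?_⟩
  · rw [integral_meanTwoPoint h1 h2, chordAt_id (h1.trans h2)]
  · rw [integral_meanTwoPoint h1 h2, hs]

/-- If `ψ` has positive expectation on the whole ambiguity set, then so it has on the mixture with
dispersion `s` of two two-point distributions with dispersions on either side of `s`. -/
theorem mixture_pos {μ s : ℝ} {φ ψ : ℝ → ℝ}
    (hpos : ∀ P : Measure ℝ, memAmb μ s φ P → 0 < ∫ x, ψ x ∂P) {a b c d : ℝ}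
    (ha : a < μ) (hb : μ < b) (hc : c < μ) (hd : μ < d)
    (h1 : chordAt μ φ a b ≤ s) (h2 : s < chordAt μ φ c d) :
    0 < (chordAt μ φ c d - s) * chordAt μ ψ a b + (s - chordAt μ φ a b) * chordAt μ ψ c d := by
  set d1 := chordAt μ φ a b with hd1
  set d2 := chordAt μ φ c d with hd2
  have hD : 0 < d2 - d1 := by linarith
  set p := (d2 - s) / (d2 - d1) with hp
  set q := (s - d1) / (d2 - d1) with hq
  have hp0 : 0 ≤ p := div_nonneg (by linarith) hD.le
  have hq0 : 0 ≤ q := div_nonneg (by linarith) hD.le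
  have hpq : p + q = 1 := by rw [hp, hq]; field_simp; ring
  let Q : Measure ℝ := ENNReal.ofReal p • meanTwoPoint μ a b + ENNReal.ofReal q • meanTwoPoint μ c d
  have i1 : ∀ f : ℝ → ℝ, Integrable f (ENNReal.ofReal p • meanTwoPoint μ a b) := fun f =>
    (integrable_twoPoint _ _ _ _ f).smul_measure ENNReal.ofReal_ne_top
  have i2 : ∀ f : ℝ → ℝ, Integrable f (ENNReal.ofReal q • meanTwoPoint μ c d) := fun f =>
    (integrable_twoPoint _ _ _ _ f).smul_measure ENNReal.ofReal_ne_top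
  have hQ : ∀ f : ℝ → ℝ, ∫ x, f x ∂Q = p * chordAt μ f a b + q * chordAt μ f c d := by
    intro f
    rw [integral_add_measure (i1 f) (i2 f), integral_smul_measure, integral_smul_measure,
      integral_meanTwoPoint ha hb, integral_meanTwoPoint hc hd, ENNReal.toReal_ofReal hp0,
      ENNReal.toReal_ofReal hq0, smul_eq_mul, smul_eq_mul]
  have hmem : memAmb μ s φ Q := by
    refine ⟨⟨?_⟩, (i1 _).add_measure (i2 _), ?_, (i1 _).add_measure (i2 _), ?_⟩
    · have := (memAmb_meanTwoPoint (φ := φ) ha hb rfl).1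
      have := (memAmb_meanTwoPoint (φ := φ) hc hd rfl).1
      simp [Q, ← ENNReal.ofReal_add hp0 hq0, hpq]
    · rw [hQ, chordAt_id (ha.trans hb), chordAt_id (hc.trans hd), ← add_mul, hpq, one_mul]
    · rw [hQ, ← hd1, ← hd2, hp, hq]; field_simp; ring
  have key := hpos Q hmem
  rw [hQ, hp, hq] at key
  have := mul_pos key hD
  field_simp at this
  linarith

theorem DispersionOK.convexOn {μ : ℝ} {φ : ℝ → ℝ} (hφ : DispersionOK μ φ) :
    ConvexOn ℝ Set.univ φ := hφ.strict_convex.convexOn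

theorem DispersionOK.continuous {μ : ℝ} {φ : ℝ → ℝ} (hφ : DispersionOK μ φ) : Continuous φ := by
  have := hφ.convexOn.continuousOn_interior
  rwa [interior_univ, continuousOn_univ] at this

theorem DispersionOK.nonneg {μ : ℝ} {φ : ℝ → ℝ} (hφ : DispersionOK μ φ) (x : ℝ) : 0 ≤ φ x :=
  hφ.zero ▸ hφ.isMin x

theorem DispersionOK.tendsto_chordAt_atTop {μ : ℝ} {φ : ℝ → ℝ} (hφ : DispersionOK μ φ) {v1 : ℝ}
    (h1 : v1 < μ) : Tendsto (fun v => chordAt μ φ v1 v) atTop atTop := by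
  have hg : Tendsto (fun x : ℝ => |φ x / x|) atTop atTop := hφ.growth.mono_left atTop_le_cocompact
  have hg' := hg.const_mul_atTop (show 0 < (μ - v1) / 2 by linarith)
  refine tendsto_atTop_mono' _ ?_ hg'
  filter_upwards [eventually_gt_atTop μ, eventually_gt_atTop 0, eventually_gt_atTop (-v1)]
    with v hv h0 hv'
  have hp : 0 < v - v1 := by linarith
  rw [chordAt_eq_div _ (by linarith), abs_of_nonneg (div_nonneg (hφ.nonneg v) h0.le),
    le_div_iff₀ hp]
  have e : (μ - v1) / 2 * (φ v / v) * (v - v1) = (μ - v1) * φ v * ((v - v1) / (2 * v)) := by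
    field_simp
  have h3 : (v - v1) / (2 * v) ≤ 1 := by rw [div_le_one (by linarith)]; linarith
  have h4 : 0 ≤ (μ - v1) * φ v := mul_nonneg (by linarith) (hφ.nonneg v)
  have h5 : 0 ≤ (v - μ) * φ v1 := mul_nonneg (by linarith) (hφ.nonneg v1)
  rw [e]
  nlinarith [mul_le_mul_of_nonneg_left h3 h4]

theorem DispersionOK.tendsto_chordAt_atBot {μ : ℝ} {φ : ℝ → ℝ} (hφ : DispersionOK μ φ) {v2 : ℝ}
    (h2 : μ < v2) : Tendsto (fun v => chordAt μ φ v v2) atBot atTop := by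
  have hg : Tendsto (fun x : ℝ => |φ x / x|) atBot atTop := hφ.growth.mono_left atBot_le_cocompact
  have hg' := hg.const_mul_atTop (show 0 < (v2 - μ) / 2 by linarith)
  refine tendsto_atTop_mono' _ ?_ hg'
  filter_upwards [eventually_lt_atBot μ, eventually_lt_atBot 0, eventually_lt_atBot (-v2)]
    with v hv h0 hv'
  have hp : 0 < v2 - v := by linarith
  rw [chordAt_eq_div _ (by linarith),
    abs_of_nonpos (div_nonpos_of_nonneg_of_nonpos (hφ.nonneg v) h0.le), le_div_iff₀ hp]
  have e : (v2 - μ) / 2 * -(φ v / v) * (v2 - v) = (v2 - μ) * φ v * ((v2 - v) / (2 * -v)) := by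
    field_simp
  have h3 : (v2 - v) / (2 * -v) ≤ 1 := by rw [div_le_one (by linarith)]; linarith
  have h4 : 0 ≤ (v2 - μ) * φ v := mul_nonneg (by linarith) (hφ.nonneg v)
  have h5 : 0 ≤ (μ - v) * φ v2 := mul_nonneg (by linarith) (hφ.nonneg v2)
  rw [e]
  nlinarith [mul_le_mul_of_nonneg_left h3 h4]

theorem continuousAt_chordAt {μ v1 v : ℝ} {f : ℝ → ℝ} (h : v1 < v) (hf : ContinuousAt f v) :
    ContinuousAt (fun x => chordAt μ f v1 x) v := by
  unfold chordAt
  have : v - v1 ≠ 0 := by linarith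
  fun_prop (disch := assumption)

theorem chordAt_mono_right {μ v1 v v' : ℝ} {f : ℝ → ℝ} (hf : ConvexOn ℝ Set.univ f) (h1 : v1 < μ)
    (h2 : μ < v) (h : v ≤ v') : chordAt μ f v1 v ≤ chordAt μ f v1 v' := by
  have e : ∀ x, v1 < x → chordAt μ f v1 x = f v1 + (μ - v1) * ((f x - f v1) / (x - v1)) := by
    intro x hx
    unfold chordAt
    ring
  rw [e v (by linarith), e v' (by linarith)]
  have := hf.secant_mono (a := v1) trivial (Set.mem_univ v) (Set.mem_univ v')
    (by linarith) (by linarith) h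
  have h3 : 0 ≤ μ - v1 := by linarith
  gcongr

/-- The right point can be moved outwards until the dispersion is exactly `s`. -/
theorem DispersionOK.exists_chordAt_eq {μ s : ℝ} {φ : ℝ → ℝ} (hφ : DispersionOK μ φ) {v1 v2 : ℝ}
    (h1 : v1 < μ) (h2 : μ < v2) (h : chordAt μ φ v1 v2 ≤ s) :
    ∃ v, v2 ≤ v ∧ chordAt μ φ v1 v = s := by
  obtain ⟨M, hM, hM2⟩ := (((hφ.tendsto_chordAt_atTop h1).eventually_ge_atTop s).and
    (eventually_ge_atTop v2)).exists
  have hcont : ContinuousOn (fun v => chordAt μ φ v1 v) (Set.Icc v2 M) := fun v hv =>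
    (continuousAt_chordAt (by linarith [hv.1]) hφ.continuous.continuousAt).continuousWithinAt
  obtain ⟨v, hv, hv'⟩ := intermediate_value_Icc hM2 hcont ⟨h, hM⟩
  exact ⟨v, hv.1, hv'⟩

/-- A function that is bounded above near `+∞` and has positive expectation on the ambiguity set
has nonnegative expectation on all two-point distributions of mean `μ` and smaller dispersion. -/
theorem chordAt_nonneg {μ s t : ℝ} {φ ψ : ℝ → ℝ} (hφ : DispersionOK μ φ)
    (hψ : AntitoneOn ψ (Set.Ici t))
    (hpos : ∀ P : Measure ℝ, memAmb μ s φ P → 0 < ∫ x, ψ x ∂P) {v1 v2 : ℝ}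
    (h1 : v1 < μ) (h2 : μ < v2) (h : chordAt μ φ v1 v2 ≤ s) : 0 ≤ chordAt μ ψ v1 v2 := by
  by_contra! hneg
  set D := chordAt μ ψ v1 v2
  set C := |ψ v1| + |ψ t|
  set K := (s - chordAt μ φ v1 v2) * C / (-D)
  obtain ⟨M, ⟨⟨hM, hMs⟩, hMt⟩, hMμ⟩ := ((((hφ.tendsto_chordAt_atTop h1).eventually_gt_atTop (s + K)).and
    ((hφ.tendsto_chordAt_atTop h1).eventually_gt_atTop s)).and
    (eventually_ge_atTop t)).and (eventually_gt_atTop μ) |>.exists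
  have key := mixture_pos hpos h1 h2 h1 hMμ h hMs
  have hC : chordAt μ ψ v1 M ≤ C := by
    have ⟨a1, a2⟩ := weight_mem_Icc h1 hMμ
    have b1 : ψ v1 ≤ |ψ v1| := le_abs_self _
    have b2 : ψ M ≤ |ψ t| := (hψ Set.self_mem_Ici hMt hMt).trans (le_abs_self _)
    unfold chordAt
    nlinarith [mul_le_mul_of_nonneg_left b1 a1, mul_le_mul_of_nonneg_left b2 a2,
      abs_nonneg (ψ v1), abs_nonneg (ψ t)]
  have hK : K * (-D) = (s - chordAt μ φ v1 v2) * C := by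
    simp only [K]; field_simp [hneg.ne]
  nlinarith [mul_le_mul_of_nonneg_left hC (sub_nonneg.2 h)]

/-- If the quotient of a concave function `n` and a nonnegative convex function `g` is largest at
the right end, while `n` is positive and `g` vanishes at the left end, then `g` vanishes. -/
theorem eq_zero_of_ratio_le_right {n g : ℝ → ℝ} {a b : ℝ}
    (hn : ConcaveOn ℝ (Set.Icc a b) n) (hg : ConvexOn ℝ (Set.Icc a b) g) (hna : 0 < n a)
    (hga : g a ≤ 0) (hnb : 0 ≤ n b) (hg0 : ∀ v ∈ Set.Ioc a b, 0 ≤ g v)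
    (hr : ∀ v ∈ Set.Ioo a b, n v / g v ≤ n b / g b) : ∀ v ∈ Set.Ioo a b, g v = 0 := by
  intro v hv
  have hab : a < b := hv.1.trans hv.2
  have hba : 0 < b - a := by linarith
  set l := (v - a) / (b - a) with hl
  have l0 : 0 < l := div_pos (by linarith [hv.1]) hba
  have l1 : l < 1 := by rw [hl, div_lt_one hba]; linarith [hv.2]
  have hvl : (1 - l) * a + l * b = v := by rw [hl]; field_simp; ring
  have ha : a ∈ Set.Icc a b := ⟨le_rfl, hab.le⟩
  have hb : b ∈ Set.Icc a b := ⟨hab.le, le_rfl⟩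
  have cn := hn.2 ha hb (sub_nonneg.2 l1.le) l0.le (by ring)
  have cg := hg.2 ha hb (sub_nonneg.2 l1.le) l0.le (by ring)
  simp only [smul_eq_mul, hvl] at cn cg
  have gv := hg0 v ⟨hv.1, hv.2.le⟩
  have gb := hg0 b ⟨hab, le_rfl⟩
  have gle : g v ≤ l * g b := by nlinarith
  by_contra hne
  have gvp : 0 < g v := lt_of_le_of_ne gv (Ne.symm hne)
  have gbp : 0 < g b := by
    by_contra! h
    nlinarith
  have hq := hr v hv
  rw [div_le_div_iff₀ gvp gbp] at hq
  have k1 : n b * g v ≤ n b * (l * g b) := mul_le_mul_of_nonneg_left gle hnb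
  have k2 : n v * g b ≤ l * n b * g b := by linarith
  have k3 : n v ≤ l * n b := le_of_mul_le_mul_right k2 gbp
  nlinarith

/-- The numerator of `chordAt μ f v1 v` over the common denominator `v - v1`. -/
def chordNum (μ : ℝ) (f : ℝ → ℝ) (v1 v : ℝ) : ℝ := (v - μ) * f v1 + (μ - v1) * f v

theorem chordAt_eq_chordNum_div {μ v1 v : ℝ} (f : ℝ → ℝ) (h : v1 < v) :
    chordAt μ f v1 v = chordNum μ f v1 v / (v - v1) := chordAt_eq_div f h

theorem chordNum_eq_mul {μ v1 v : ℝ} (f : ℝ → ℝ) (h : v1 < v) :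
    chordNum μ f v1 v = chordAt μ f v1 v * (v - v1) := by
  rw [chordAt_eq_chordNum_div f h, div_mul_cancel₀ _ (by linarith)]

theorem chordAt_div_chordAt {μ v1 v : ℝ} (f g : ℝ → ℝ) (h : v1 < v) :
    chordAt μ f v1 v / chordAt μ g v1 v = chordNum μ f v1 v / chordNum μ g v1 v := by
  rw [chordAt_eq_chordNum_div f h, chordAt_eq_chordNum_div g h,
    div_div_div_cancel_right₀ (by linarith)]

theorem ConvexOn.chordNum {μ v1 : ℝ} {S : Set ℝ} {f : ℝ → ℝ} (hf : ConvexOn ℝ S f) (h1 : v1 < μ) :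
    ConvexOn ℝ S (chordNum μ f v1) := by
  refine ⟨hf.1, fun x hx y hy a b ha hb hab => ?_⟩
  have h := hf.2 hx hy ha hb hab
  simp only [smul_eq_mul, _root_.chordNum] at h ⊢
  have hb' : b = 1 - a := by linarith
  subst hb'
  nlinarith [mul_le_mul_of_nonneg_left h (sub_nonneg.2 h1.le)]

theorem ConcaveOn.chordNum {μ v1 : ℝ} {S : Set ℝ} {f : ℝ → ℝ} (hf : ConcaveOn ℝ S f)
    (h1 : v1 < μ) : ConcaveOn ℝ S (chordNum μ f v1) := by
  refine ⟨hf.1, fun x hx y hy a b ha hb hab => ?_⟩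
  have h := hf.2 hx hy ha hb hab
  simp only [smul_eq_mul, _root_.chordNum] at h ⊢
  have hb' : b = 1 - a := by linarith
  subst hb'
  nlinarith [mul_le_mul_of_nonneg_left h (sub_nonneg.2 h1.le)]

section Degenerate

variable {μ s t : ℝ} {φ ψu ψl : ℝ → ℝ}

/-- A two-point distribution with right point beyond `t` at which the denominator vanishes has
nonpositive numerator. -/
theorem chordAt_nonpos_of_le_right (hφ : DispersionOK μ φ)
    (hu : ConcaveOn ℝ (Set.Ici t) ψu) (hl : ConvexOn ℝ (Set.Ici t) ψl)
    (hanti : AntitoneOn ψl (Set.Ici t))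
    (hpos : ∀ P : Measure ℝ, memAmb μ s φ P → 0 < ∫ x, ψl x ∂P)
    (hmono : ∀ v1 < μ, MonotoneOn (fun v2 => chordAt μ ψu v1 v2 / chordAt μ ψl v1 v2) (Set.Ioi μ))
    {v1 v2 : ℝ} (h1 : v1 < μ) (h2 : μ < v2) (ht : t ≤ v2) (hd : chordAt μ φ v1 v2 ≤ s)
    (hD : chordAt μ ψl v1 v2 = 0) : chordAt μ ψu v1 v2 ≤ 0 := by
  by_contra! hN
  obtain ⟨b, hb, hbs⟩ := hφ.exists_chordAt_eq h1 h2 hd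
  have hDb : 0 < chordAt μ ψl v1 b := by
    have hμb : μ < b := by linarith
    rw [← integral_meanTwoPoint h1 hμb]
    exact hpos _ (memAmb_meanTwoPoint h1 hμb hbs)
  have hlt : v2 < b := lt_of_le_of_ne hb fun h => by rw [← h] at hDb; linarith
  have hsub : Set.Icc v2 b ⊆ Set.Ici t := fun x hx => ht.trans hx.1
  have hratio : ∀ v ∈ Set.Icc v2 b, chordNum μ ψu v1 v / chordNum μ ψl v1 v ≤
      chordNum μ ψu v1 b / chordNum μ ψl v1 b := by
    intro v hv
    rw [← chordAt_div_chordAt _ _ (by linarith [hv.1]), ← chordAt_div_chordAt _ _ (by linarith)]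
    exact hmono v1 h1 (h2.trans_le hv.1) (h2.trans hlt) hv.2
  have num := fun (f : ℝ → ℝ) (v : ℝ) (hv : μ < v) => chordNum_eq_mul (μ := μ) f (h1.trans hv)
  have gb : 0 < chordNum μ ψl v1 b := by
    rw [num _ _ (h2.trans hlt)]; exact mul_pos hDb (by linarith)
  have ga : chordNum μ ψl v1 v2 = 0 := by rw [num _ _ h2, hD, zero_mul]
  have na : 0 < chordNum μ ψu v1 v2 := by
    rw [num _ _ h2]; exact mul_pos hN (by linarith)
  have nb : 0 ≤ chordNum μ ψu v1 b := by
    have := hratio v2 ⟨le_rfl, hlt.le⟩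
    rw [ga, div_zero] at this
    by_contra! h
    linarith [div_neg_of_neg_of_pos h gb]
  have hz := eq_zero_of_ratio_le_right ((hu.subset hsub (convex_Icc _ _)).chordNum h1)
    ((hl.subset hsub (convex_Icc _ _)).chordNum h1) na ga.le nb
    (fun v hv => by
      rw [num _ _ (h2.trans hv.1)]
      refine mul_nonneg (chordAt_nonneg hφ hanti hpos h1 (h2.trans hv.1) ?_) (by linarith [hv.1])
      exact hbs ▸ chordAt_mono_right hφ.convexOn h1 (h2.trans hv.1) hv.2)
    (fun v hv => hratio v ⟨hv.1.le, hv.2.le⟩)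
  have hcont : ContinuousAt (chordNum μ ψl v1) b := by
    have := (hl.chordNum h1).continuousOn_interior
    rw [interior_Ici] at this
    exact this.continuousAt (Ioi_mem_nhds (ht.trans_lt hlt))
  have hev : ∀ᶠ v in nhdsWithin b (Set.Iio b), v ∈ Set.Ioo v2 b := Ioo_mem_nhdsLT hlt
  have hev2 : ∀ᶠ v in nhdsWithin b (Set.Iio b), 0 < chordNum μ ψl v1 v :=
    (hcont.eventually (lt_mem_nhds gb)).filter_mono nhdsWithin_le_nhds
  obtain ⟨v, hv, hv'⟩ := (hev.and hev2).exists
  exact hv'.ne' (hz v hv)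

/-- Left of `t`, the denominator and the numerator at `μ` cannot be nonpositive and positive,
respectively. -/
theorem nonpos_of_mean_lt (hs : 0 < s) (hφ : DispersionOK μ φ)
    (hu : ConcaveOn ℝ (Set.Iio t) ψu) (hl : ConvexOn ℝ (Set.Iio t) ψl)
    (hanti : AntitoneOn ψl (Set.Ici t))
    (hpos : ∀ P : Measure ℝ, memAmb μ s φ P → 0 < ∫ x, ψl x ∂P)
    (hmono : ∀ v1 < μ, MonotoneOn (fun v2 => chordAt μ ψu v1 v2 / chordAt μ ψl v1 v2) (Set.Ioi μ))
    (ht : μ < t) (hD : ψl μ ≤ 0) : ψu μ ≤ 0 := by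
  by_contra! hN
  have hucont : ContinuousAt ψu μ := by
    have := hu.continuousOn_interior
    rw [interior_Iio] at this
    exact this.continuousAt (Iio_mem_nhds ht)
  have key : ∀ a < μ, ∃ b, μ < b ∧ ∀ v ∈ Set.Ioo μ b,
      chordNum μ ψl a v = 0 ∧ chordAt μ φ a v ≤ s := by
    intro a ha
    have e1 : ∀ᶠ v in nhdsWithin μ (Set.Ioi μ), chordAt μ φ a v < s := by
      refine Eventually.filter_mono nhdsWithin_le_nhds
        ((continuousAt_chordAt ha hφ.continuous.continuousAt).eventually (gt_mem_nhds ?_))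
      beta_reduce
      rw [chordAt_eq_div _ ha, hφ.zero]
      simpa using hs
    have e2 : ∀ᶠ v in nhdsWithin μ (Set.Ioi μ), 0 < chordAt μ ψu a v := by
      refine Eventually.filter_mono nhdsWithin_le_nhds
        ((continuousAt_chordAt ha hucont).eventually (lt_mem_nhds ?_))
      beta_reduce
      rw [chordAt_eq_div _ ha]
      have : 0 < μ - a := by linarith
      simp only [sub_self, zero_mul, zero_add]
      positivity
    have e3 : ∀ᶠ v in nhdsWithin μ (Set.Ioi μ), v ∈ Set.Ioo μ t := Ioo_mem_nhdsGT ht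
    obtain ⟨b, ⟨hb1, hb2⟩, hb⟩ := ((e1.and e2).and e3).exists
    have hd : ∀ v ∈ Set.Ioc μ b, chordAt μ φ a v ≤ s := fun v hv =>
      (chordAt_mono_right hφ.convexOn ha hv.1 hv.2).trans hb1.le
    have num := fun (f : ℝ → ℝ) (v : ℝ) (hv : μ < v) => chordNum_eq_mul (μ := μ) f (ha.trans hv)
    have hsub : Set.Icc μ b ⊆ Set.Iio t := fun x hx => hx.2.trans_lt hb.2
    refine ⟨b, hb.1, fun v hv => ⟨?_, hd v ⟨hv.1, hv.2.le⟩⟩⟩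
    refine eq_zero_of_ratio_le_right ((hu.subset hsub (convex_Icc _ _)).chordNum ha)
      ((hl.subset hsub (convex_Icc _ _)).chordNum ha) ?_ ?_ ?_ ?_ ?_ v hv
    · have : 0 < μ - a := by linarith
      simp only [chordNum, sub_self, zero_mul, zero_add]
      positivity
    · simp only [chordNum, sub_self, zero_mul, zero_add]
      exact mul_nonpos_of_nonneg_of_nonpos (by linarith) hD
    · rw [num _ _ hb.1]
      exact mul_nonneg hb2.le (by linarith [hb.1])
    · intro v hv
      rw [num _ _ hv.1]
      exact mul_nonneg (chordAt_nonneg hφ hanti hpos ha hv.1 (hd v hv)) (by linarith [hv.1])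
    · intro v hv
      rw [← chordAt_div_chordAt _ _ (by linarith [hv.1]),
        ← chordAt_div_chordAt _ _ (by linarith [hb.1])]
      exact hmono a ha hv.1 hb.1 hv.2.le
  have ha0 : μ - 1 < μ := by linarith
  obtain ⟨b0, hb0, h0⟩ := key (μ - 1) ha0
  obtain ⟨c, hc⟩ := exists_between hb0
  obtain ⟨a, ha, has⟩ := ((eventually_lt_atBot μ).and
    ((hφ.tendsto_chordAt_atBot hc.1).eventually_gt_atTop s)).exists
  obtain ⟨b, hb, hab⟩ := key a ha
  obtain ⟨v, hv⟩ := exists_between (lt_min hb hb0)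
  have z1 := (hab v ⟨hv.1, hv.2.trans_le (min_le_left _ _)⟩).1
  have z2 := (h0 v ⟨hv.1, hv.2.trans_le (min_le_right _ _)⟩).1
  have z3 := (h0 c hc).1
  simp only [chordNum, sub_sub_cancel, one_mul] at z1 z2 z3
  have z4 : chordAt μ ψl a c = 0 := by
    rw [chordAt_eq_div _ (ha.trans hc.1), div_eq_zero_iff]
    left
    have hvμ : v - μ ≠ 0 := by linarith [hv.1]
    have : ψl a = (μ - a) * ψl (μ - 1) := by
      have : (v - μ) * (ψl a - (μ - a) * ψl (μ - 1)) = 0 := by linear_combination z1 - (μ - a) * z2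
      rcases mul_eq_zero.1 this with h | h
      · exact absurd h hvμ
      · linarith
    rw [this]
    linear_combination (μ - a) * z3
  have z5 : chordAt μ ψl (μ - 1) c = 0 := by
    rw [chordAt_eq_div _ (by linarith [hc.1]), div_eq_zero_iff]
    left
    linear_combination z3
  have := mixture_pos hpos ha0 hc.1 ha hc.1 (h0 c hc).2 has
  rw [z4, z5] at this
  simp at this

/-- A mean-`μ` two-point distribution of dispersion at most `s` at which the denominator vanishes
has nonpositive numerator. -/
theorem chordAt_nonpos_of_chordAt_eq_zero (hs : 0 < s) (hφ : DispersionOK μ φ)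
    (hu₁ : ConcaveOn ℝ (Set.Iio t) ψu) (hu₂ : ConcaveOn ℝ (Set.Ici t) ψu)
    (hl₁ : ConvexOn ℝ (Set.Iio t) ψl) (hl₂ : ConvexOn ℝ (Set.Ici t) ψl)
    (hanti : AntitoneOn ψl (Set.Ici t))
    (hpos : ∀ P : Measure ℝ, memAmb μ s φ P → 0 < ∫ x, ψl x ∂P)
    (hmono : ∀ v1 < μ, MonotoneOn (fun v2 => chordAt μ ψu v1 v2 / chordAt μ ψl v1 v2) (Set.Ioi μ))
    {v1 v2 : ℝ} (h1 : v1 < μ) (h2 : μ < v2) (hd : chordAt μ φ v1 v2 ≤ s)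
    (hD : chordAt μ ψl v1 v2 = 0) : chordAt μ ψu v1 v2 ≤ 0 := by
  rcases le_or_gt t v2 with ht | ht
  · exact chordAt_nonpos_of_le_right hφ hu₂ hl₂ hanti hpos hmono h1 h2 ht hd hD
  have ⟨w1, w2⟩ := weight_mem_Icc h1 h2
  have m1 : v1 ∈ Set.Iio t := (h1.trans h2).trans ht
  have hμ : (1 - (μ - v1) / (v2 - v1)) * v1 + (μ - v1) / (v2 - v1) * v2 = μ :=
    chordAt_id (h1.trans h2)
  have jl := hl₁.2 m1 ht w1 w2 (by ring)
  have ju := hu₁.2 m1 ht w1 w2 (by ring)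
  simp only [smul_eq_mul, hμ] at jl ju
  exact le_trans ju
    (nonpos_of_mean_lt hs hφ hu₁ hl₁ hanti hpos hmono (h2.trans ht) (jl.trans_eq hD))

end Degenerate

theorem AffineOn.convexOn {ψ : ℝ → ℝ} {S : Set ℝ} (h : AffineOn ψ S) (hS : Convex ℝ S) :
    ConvexOn ℝ S ψ := by
  obtain ⟨a, b, hab⟩ := h
  refine ⟨hS, fun x hx y hy p q hp hq hpq => le_of_eq ?_⟩
  rw [hab _ (hS hx hy hp hq hpq), hab x hx, hab y hy]
  simp only [smul_eq_mul]
  linear_combination (-b) * hpq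

theorem AffineOn.neg {ψ : ℝ → ℝ} {S : Set ℝ} (h : AffineOn ψ S) : AffineOn (-ψ) S := by
  obtain ⟨a, b, hab⟩ := h
  exact ⟨-a, -b, fun x hx => by rw [Pi.neg_apply, hab x hx]; ring⟩

theorem chordAt_neg (μ : ℝ) (f : ℝ → ℝ) (v1 v2 : ℝ) :
    chordAt μ (-f) v1 v2 = -chordAt μ f v1 v2 := by
  simp only [chordAt, Pi.neg_apply]; ring

/-- Reduction of the semi-infinite fractional program to two-point distributions.
The suprema are taken in the extended reals. -/
theorem stmt3 (μ s t : ℝ) (φ ψu ψl : ℝ → ℝ) (hs : 0 < s) (hφ : DispersionOK μ φ)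
    (hψu_conc₁ : ConcaveOn ℝ (Set.Iio t) ψu) (hψu_mono₁ : MonotoneOn ψu (Set.Iio t))
    (hψu_conc₂ : ConcaveOn ℝ (Set.Ici t) ψu) (hψu_mono₂ : MonotoneOn ψu (Set.Ici t))
    (hψl_conv₁ : ConvexOn ℝ (Set.Iio t) ψl) (hψl_anti₁ : AntitoneOn ψl (Set.Iio t))
    (hψl_conv₂ : ConvexOn ℝ (Set.Ici t) ψl) (hψl_anti₂ : AntitoneOn ψl (Set.Ici t))
    (hint : ∀ P : Measure ℝ, memAmb μ s φ P →
      Integrable ψu P ∧ Integrable ψl P ∧ 0 < ∫ x, ψl x ∂P)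
    (hsign : (∃ P : Measure ℝ, memAmb μ s φ P ∧ 0 ≤ ∫ x, ψu x ∂P) ∨
      (AffineOn ψl (Set.Iio t) ∧ AffineOn ψl (Set.Ici t)))
    (hmono : ∀ v1 < μ, MonotoneOn (fun v2 =>
        ((1 - (μ - v1) / (v2 - v1)) * ψu v1 + ((μ - v1) / (v2 - v1)) * ψu v2) /
        ((1 - (μ - v1) / (v2 - v1)) * ψl v1 + ((μ - v1) / (v2 - v1)) * ψl v2))
      (Set.Ioi μ)) :
    sSup {y : EReal | ∃ P : Measure ℝ, memAmb μ s φ P ∧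
        y = (((∫ x, ψu x ∂P) / (∫ x, ψl x ∂P) : ℝ) : EReal)} =
    sSup {y : EReal | ∃ v1 w1 v2 w2 : ℝ, v1 < μ ∧ μ < v2 ∧ 0 ≤ w1 ∧ 0 ≤ w2 ∧ w1 + w2 = 1 ∧
        memAmb μ s φ (twoPoint v1 w1 v2 w2) ∧
        y = (((w1 * ψu v1 + w2 * ψu v2) / (w1 * ψl v1 + w2 * ψl v2) : ℝ) : EReal)} := by
  have hpos : ∀ P : Measure ℝ, memAmb μ s φ P → 0 < ∫ x, ψl x ∂P := fun P hP => (hint P hP).2.2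
  have hmono' : ∀ v1 < μ,
      MonotoneOn (fun v2 => chordAt μ ψu v1 v2 / chordAt μ ψl v1 v2) (Set.Ioi μ) := hmono
  have hreduce : ∀ P : Measure ℝ, memAmb μ s φ P →
      ((0 ≤ ∫ x, ψu x ∂P) ∨ (AffineOn ψl (Set.Iio t) ∧ AffineOn ψl (Set.Ici t))) →
      ∃ v1 v2, v1 < μ ∧ μ < v2 ∧ chordAt μ φ v1 v2 = s ∧
        (∫ x, ψu x ∂P) / (∫ x, ψl x ∂P) ≤ chordAt μ ψu v1 v2 / chordAt μ ψl v1 v2 := by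
    intro P hP hcase
    obtain ⟨hui, hli, hlpos⟩ := hint P hP
    obtain ⟨hprob, hid, hmean, hφi, hφs⟩ := hP
    have hne : ¬ ∀ᵐ x ∂P, x = μ := by
      intro h
      have : ∫ x, φ x ∂P = ∫ _, (0 : ℝ) ∂P :=
        integral_congr_ae (h.mono fun x hx => by simp only [hx, hφ.zero])
      rw [hφs, integral_zero] at this
      exact hs.ne' this
    obtain ⟨v1, v2, h1, h2, hQ⟩ := exists_twoPoint_le_integral t hid hmean hne
    have dφ : chordAt μ φ v1 v2 ≤ s := hφs ▸ hQ φ hφi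
      (hφ.convexOn.subset (Set.subset_univ _) (convex_Iio t))
      (hφ.convexOn.subset (Set.subset_univ _) (convex_Ici t))
    have dl := hQ ψl hli hψl_conv₁ hψl_conv₂
    have du := hQ (-ψu) hui.neg hψu_conc₁.neg hψu_conc₂.neg
    simp only [chordAt_neg, Pi.neg_apply, integral_neg, neg_le_neg_iff] at du
    have hratio : (∫ x, ψu x ∂P) / (∫ x, ψl x ∂P) ≤ chordAt μ ψu v1 v2 / chordAt μ ψl v1 v2 := by
      rcases hcase with hnn | ⟨ha1, ha2⟩
      · have hD := chordAt_nonneg hφ hψl_anti₂ hpos h1 h2 dφ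
        rcases hD.eq_or_lt with hD | hD
        · have hN := chordAt_nonpos_of_chordAt_eq_zero hs hφ hψu_conc₁ hψu_conc₂ hψl_conv₁
            hψl_conv₂ hψl_anti₂ hpos hmono' h1 h2 dφ hD.symm
          rw [← hD, div_zero, le_antisymm (du.trans hN) hnn, zero_div]
        · exact div_le_div₀ (hnn.trans du) du hD dl
      · have dl' := hQ (-ψl) hli.neg (ha1.neg.convexOn (convex_Iio t))
          (ha2.neg.convexOn (convex_Ici t))
        simp only [chordAt_neg, Pi.neg_apply, integral_neg, neg_le_neg_iff] at dl'
        rw [le_antisymm dl dl']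
        exact div_le_div_of_nonneg_right du hlpos.le
    obtain ⟨v, hv, hvs⟩ := hφ.exists_chordAt_eq h1 h2 dφ
    exact ⟨v1, v, h1, h2.trans_le hv, hvs, hratio.trans (hmono' v1 h1 h2 (h2.trans_le hv) hv)⟩
  set B := {y : EReal | ∃ v1 w1 v2 w2 : ℝ, v1 < μ ∧ μ < v2 ∧ 0 ≤ w1 ∧ 0 ≤ w2 ∧ w1 + w2 = 1 ∧
        memAmb μ s φ (twoPoint v1 w1 v2 w2) ∧
        y = (((w1 * ψu v1 + w2 * ψu v2) / (w1 * ψl v1 + w2 * ψl v2) : ℝ) : EReal)}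
  have hle : ∀ P : Measure ℝ, memAmb μ s φ P →
      ((0 ≤ ∫ x, ψu x ∂P) ∨ (AffineOn ψl (Set.Iio t) ∧ AffineOn ψl (Set.Ici t))) →
      (((∫ x, ψu x ∂P) / (∫ x, ψl x ∂P) : ℝ) : EReal) ≤ sSup B := by
    intro P hP hcase
    obtain ⟨v1, v2, h1, h2, hvs, hr⟩ := hreduce P hP hcase
    have ⟨w1, w2⟩ := weight_mem_Icc h1 h2
    exact (EReal.coe_le_coe_iff.2 hr).trans (le_sSup ⟨v1, _, v2, _, h1, h2, w1, w2, by ring,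
      memAmb_meanTwoPoint h1 h2 hvs, rfl⟩)
  apply le_antisymm
  · refine sSup_le ?_
    rintro y ⟨P, hP, rfl⟩
    rcases hsign with ⟨P₀, hP₀, hnn⟩ | haff
    · rcases le_or_gt 0 (∫ x, ψu x ∂P) with h | h
      · exact hle P hP (Or.inl h)
      · refine (EReal.coe_le_coe_iff.2 ?_).trans (hle P₀ hP₀ (Or.inl hnn))
        exact (div_nonpos_of_nonpos_of_nonneg h.le (hpos P hP).le).trans
          (div_nonneg hnn (hpos P₀ hP₀).le)
    · exact hle P hP (Or.inr haff)
  · refine sSup_le_sSup ?_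
    rintro y ⟨v1, w1, v2, w2, -, -, hw1, hw2, -, hmem, rfl⟩
    exact ⟨_, hmem, by rw [integral_twoPoint hw1 hw2, integral_twoPoint hw1 hw2]⟩
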